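/- Heap progress: if the well-resolved relation H ⊢ a ~ b ~ c : A holds and H is a wr-heap, then either there exist a heap H' and a term c' such that the heap reduction H; c ~~> H'; c' holds, or there exists a location l such that c = *l. -/

import Mathlib

namespace TLL

/-- The two sorts of TLL: `U` (non-linear) and `L` (linear). -/
inductive Srt : Type
  | U | L
deriving DecidableEq

/-- TLL terms in de Bruijn representation: variables, sorts, the two Π-type
formers (irrelevant `pi0` and relevant `pi1`), the two λ-formers, application,
the erased constant `box`, and heap pointers `ptr`. -/
inductive Tm : Type
  | var  : Nat → Tm
  | srt  : Srt → Tm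
  | pi0  : Srt → Tm → Tm → Tm
  | pi1  : Srt → Tm → Tm → Tm
  | lam0 : Srt → Tm → Tm → Tm
  | lam1 : Srt → Tm → Tm → Tm
  | app  : Tm → Tm → Tm
  | box  : Tm
  | ptr  : Nat → Tm

def upr (ξ : Nat → Nat) : Nat → Nat
  | 0 => 0
  | n + 1 => ξ n + 1

def rename (ξ : Nat → Nat) : Tm → Tm
  | .var x => .var (ξ x)
  | .srt s => .srt s
  | .pi0 t A B => .pi0 t (rename ξ A) (rename (upr ξ) B)
  | .pi1 t A B => .pi1 t (rename ξ A) (rename (upr ξ) B)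
  | .lam0 t A m => .lam0 t (rename ξ A) (rename (upr ξ) m)
  | .lam1 t A m => .lam1 t (rename ξ A) (rename (upr ξ) m)
  | .app m n => .app (rename ξ m) (rename ξ n)
  | .box => .box
  | .ptr l => .ptr l

def up (σ : Nat → Tm) : Nat → Tm
  | 0 => .var 0
  | n + 1 => rename Nat.succ (σ n)

def subst (σ : Nat → Tm) : Tm → Tm
  | .var x => σ x
  | .srt s => .srt s
  | .pi0 t A B => .pi0 t (subst σ A) (subst (up σ) B)
  | .pi1 t A B => .pi1 t (subst σ A) (subst (up σ) B)
  | .lam0 t A m => .lam0 t (subst σ A) (subst (up σ) m)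
  | .lam1 t A m => .lam1 t (subst σ A) (subst (up σ) m)
  | .app m n => .app (subst σ m) (subst σ n)
  | .box => .box
  | .ptr l => .ptr l

/-- `subst1 n m` is `m[n/x]` for the topmost bound variable `x`. -/
def subst1 (n : Tm) (m : Tm) : Tm :=
  subst (fun i => match i with | 0 => n | i + 1 => .var i) m

/-- Logical one-step reduction `m ~> n`: full β-reduction with both β-rules,
closed under all structural subterm positions. -/
inductive LStep : Tm → Tm → Prop
  | beta0 {t A m n} : LStep (.app (.lam0 t A m) n) (subst1 n m)
  | beta1 {t A m n} : LStep (.app (.lam1 t A m) n) (subst1 n m)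
  | appL {m m' n} : LStep m m' → LStep (.app m n) (.app m' n)
  | appR {m n n'} : LStep n n' → LStep (.app m n) (.app m n')
  | pi0A {t A A' B} : LStep A A' → LStep (.pi0 t A B) (.pi0 t A' B)
  | pi0B {t A B B'} : LStep B B' → LStep (.pi0 t A B) (.pi0 t A B')
  | pi1A {t A A' B} : LStep A A' → LStep (.pi1 t A B) (.pi1 t A' B)
  | pi1B {t A B B'} : LStep B B' → LStep (.pi1 t A B) (.pi1 t A B')
  | lam0A {t A A' m} : LStep A A' → LStep (.lam0 t A m) (.lam0 t A' m)
  | lam0M {t A m m'} : LStep m m' → LStep (.lam0 t A m) (.lam0 t A m')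
  | lam1A {t A A' m} : LStep A A' → LStep (.lam1 t A m) (.lam1 t A' m)
  | lam1M {t A m m'} : LStep m m' → LStep (.lam1 t A m) (.lam1 t A m')

/-- Multi-step logical reduction. -/
abbrev LRed : Tm → Tm → Prop := Relation.ReflTransGen LStep

/-- Definitional equality `A ≃ B`: equivalence closure of logical reduction. -/
def Conv (A B : Tm) : Prop := Relation.EqvGen LStep A B

/-- Parallel logical reduction `m ⇒ n`. -/
inductive PStep : Tm → Tm → Prop
  | var {x} : PStep (.var x) (.var x)
  | srt {s} : PStep (.srt s) (.srt s)
  | box : PStep .box .box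
  | ptr {l} : PStep (.ptr l) (.ptr l)
  | pi0 {t A A' B B'} : PStep A A' → PStep B B' → PStep (.pi0 t A B) (.pi0 t A' B')
  | pi1 {t A A' B B'} : PStep A A' → PStep B B' → PStep (.pi1 t A B) (.pi1 t A' B')
  | lam0 {t A A' m m'} : PStep A A' → PStep m m' → PStep (.lam0 t A m) (.lam0 t A' m')
  | lam1 {t A A' m m'} : PStep A A' → PStep m m' → PStep (.lam1 t A m) (.lam1 t A' m')
  | app {m m' n n'} : PStep m m' → PStep n n' → PStep (.app m n) (.app m' n')
  | beta0 {t A m m' n n'} : PStep m m' → PStep n n' →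
      PStep (.app (.lam0 t A m) n) (subst1 n' m')
  | beta1 {t A m m' n n'} : PStep m m' → PStep n n' →
      PStep (.app (.lam1 t A m) n) (subst1 n' m')

/-- Logical contexts: lists of types (de Bruijn). -/
abbrev Ctx := List Tm

/-- `Has Γ x A`: variable `x` has type `A` in logical context `Γ`
(with the appropriate de Bruijn shifts). -/
inductive Has : Ctx → Nat → Tm → Prop
  | zero {Γ A} : Has (A :: Γ) 0 (rename Nat.succ A)
  | succ {Γ x A B} : Has Γ x A → Has (B :: Γ) (x + 1) (rename Nat.succ A)

mutual
/-- Well-formed logical contexts. -/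
inductive LWf : Ctx → Prop
  | nil : LWf []
  | cons {Γ A s} : LWf Γ → LTyped Γ A (.srt s) → LWf (A :: Γ)

/-- The logical typing judgment `Γ ⊢ m : A`. -/
inductive LTyped : Ctx → Tm → Tm → Prop
  | srt {Γ} (s : Srt) : LWf Γ → LTyped Γ (.srt s) (.srt .U)
  | var {Γ x A} : LWf Γ → Has Γ x A → LTyped Γ (.var x) A
  | pi0 {Γ A B s r} (t : Srt) :
      LTyped Γ A (.srt s) → LTyped (A :: Γ) B (.srt r) →
      LTyped Γ (.pi0 t A B) (.srt t)
  | pi1 {Γ A B s r} (t : Srt) :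
      LTyped Γ A (.srt s) → LTyped (A :: Γ) B (.srt r) →
      LTyped Γ (.pi1 t A B) (.srt t)
  | lam0 {Γ A B m} (t : Srt) :
      LTyped (A :: Γ) m B → LTyped Γ (.lam0 t A m) (.pi0 t A B)
  | lam1 {Γ A B m} (t : Srt) :
      LTyped (A :: Γ) m B → LTyped Γ (.lam1 t A m) (.pi1 t A B)
  | app0 {Γ m n A B t} :
      LTyped Γ m (.pi0 t A B) → LTyped Γ n A → LTyped Γ (.app m n) (subst1 n B)
  | app1 {Γ m n A B t} :
      LTyped Γ m (.pi1 t A B) → LTyped Γ n A → LTyped Γ (.app m n) (subst1 n B)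
  | conv {Γ m A B s} :
      LTyped Γ m A → LTyped Γ B (.srt s) → Conv A B → LTyped Γ m B
end

/-- Program context entries: either absent, or a sort-annotated type. -/
abbrev Entry := Option (Srt × Tm)

/-- Program contexts, positionally aligned with the logical context. -/
abbrev PCtx := List Entry

/-- The context constraint `Δ ▷ s`. -/
inductive Restr : PCtx → Srt → Prop
  | nil {s} : Restr [] s
  | skip {Δ s} : Restr Δ s → Restr ((none : Entry) :: Δ) s
  | u {Δ A} : Restr Δ .U → Restr (some (.U, A) :: Δ) .U
  | l {Δ s A} : Restr Δ .L → Restr (some (s, A) :: Δ) .L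

/-- Context merge `Δ₁ ∪̇ Δ₂ = Δ`: contraction on shared `U` entries,
`L` entries occur on exactly one side. -/
inductive Merge : PCtx → PCtx → PCtx → Prop
  | nil : Merge [] [] []
  | contra {Δ₁ Δ₂ Δ A} : Merge Δ₁ Δ₂ Δ →
      Merge (some (.U, A) :: Δ₁) (some (.U, A) :: Δ₂) (some (.U, A) :: Δ)
  | left {Δ₁ Δ₂ Δ A} : Merge Δ₁ Δ₂ Δ →
      Merge (some (.L, A) :: Δ₁) ((none : Entry) :: Δ₂) (some (.L, A) :: Δ)
  | right {Δ₁ Δ₂ Δ A} : Merge Δ₁ Δ₂ Δ →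
      Merge ((none : Entry) :: Δ₁) (some (.L, A) :: Δ₂) (some (.L, A) :: Δ)
  | skip {Δ₁ Δ₂ Δ} : Merge Δ₁ Δ₂ Δ →
      Merge ((none : Entry) :: Δ₁) ((none : Entry) :: Δ₂) ((none : Entry) :: Δ)

/-- `PHas Δ x s A`: the entry `x :s A` occurs in `Δ` and the rest of `Δ`
satisfies `▷ U` (so no linear entry is discarded). -/
inductive PHas : PCtx → Nat → Srt → Tm → Prop
  | zero {Δ s A} : Restr Δ .U → PHas (some (s, A) :: Δ) 0 s (rename Nat.succ A)
  | succN {Δ x s A} : PHas Δ x s A → PHas ((none : Entry) :: Δ) (x + 1) s (rename Nat.succ A)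
  | succU {Δ x s A B} : PHas Δ x s A → PHas (some (.U, B) :: Δ) (x + 1) s (rename Nat.succ A)

/-- Well-formed pairs of logical and program contexts `Γ ; Δ ⊢`. -/
inductive PWf : Ctx → PCtx → Prop
  | nil : PWf [] []
  | cons {Γ Δ A s} : PWf Γ Δ → LTyped Γ A (.srt s) → PWf (A :: Γ) (some (s, A) :: Δ)
  | consN {Γ Δ A s} : PWf Γ Δ → LTyped Γ A (.srt s) → PWf (A :: Γ) ((none : Entry) :: Δ)

/-- The program typing judgment `Γ ; Δ ⊢ m : A`. -/
inductive PTyped : Ctx → PCtx → Tm → Tm → Prop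
  | var {Γ Δ x s A} : PWf Γ Δ → PHas Δ x s A → PTyped Γ Δ (.var x) A
  | lam0 {Γ Δ A B m} (t : Srt) :
      PTyped (A :: Γ) ((none : Entry) :: Δ) m B → Restr Δ t →
      PTyped Γ Δ (.lam0 t A m) (.pi0 t A B)
  | lam1 {Γ Δ A B m s} (t : Srt) :
      PTyped (A :: Γ) (some (s, A) :: Δ) m B → Restr Δ t →
      PTyped Γ Δ (.lam1 t A m) (.pi1 t A B)
  | app0 {Γ Δ m n A B t} :
      PTyped Γ Δ m (.pi0 t A B) → LTyped Γ n A →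
      PTyped Γ Δ (.app m n) (subst1 n B)
  | app1 {Γ Δ₁ Δ₂ Δ m n A B t} :
      PTyped Γ Δ₁ m (.pi1 t A B) → PTyped Γ Δ₂ n A → Merge Δ₁ Δ₂ Δ →
      PTyped Γ Δ (.app m n) (subst1 n B)
  | conv {Γ Δ m A B s} :
      PTyped Γ Δ m A → LTyped Γ B (.srt s) → Conv A B →
      PTyped Γ Δ m B

/-- Program values. -/
inductive Value : Tm → Prop
  | var {x} : Value (.var x)
  | lam0 {t A m} : Value (.lam0 t A m)
  | lam1 {t A m} : Value (.lam1 t A m)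

/-- Program (call-by-value) one-step reduction `m ~~> n`. -/
inductive CStep : Tm → Tm → Prop
  | appL {m m' n} : CStep m m' → CStep (.app m n) (.app m' n)
  | appR {m n n'} : CStep n n' → CStep (.app m n) (.app m n')
  | beta0 {t A m n} : CStep (.app (.lam0 t A m) n) (subst1 n m)
  | beta1 {t A m v} : Value v → CStep (.app (.lam1 t A m) v) (subst1 v m)

/-- The erasure judgment `Γ ; Δ ⊢ m ~ m' : A`. -/
inductive Erase : Ctx → PCtx → Tm → Tm → Tm → Prop
  | var {Γ Δ x s A} : PWf Γ Δ → PHas Δ x s A → Erase Γ Δ (.var x) (.var x) A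
  | lam0 {Γ Δ A B m m'} (t : Srt) :
      Erase (A :: Γ) ((none : Entry) :: Δ) m m' B → Restr Δ t →
      Erase Γ Δ (.lam0 t A m) (.lam0 t .box m') (.pi0 t A B)
  | lam1 {Γ Δ A B m m' s} (t : Srt) :
      Erase (A :: Γ) (some (s, A) :: Δ) m m' B → Restr Δ t →
      Erase Γ Δ (.lam1 t A m) (.lam1 t .box m') (.pi1 t A B)
  | app0 {Γ Δ m m' n A B t} :
      Erase Γ Δ m m' (.pi0 t A B) → LTyped Γ n A →
      Erase Γ Δ (.app m n) (.app m' .box) (subst1 n B)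
  | app1 {Γ Δ₁ Δ₂ Δ m m' n n' A B t} :
      Erase Γ Δ₁ m m' (.pi1 t A B) → Erase Γ Δ₂ n n' A → Merge Δ₁ Δ₂ Δ →
      Erase Γ Δ (.app m n) (.app m' n') (subst1 n B)
  | conv {Γ Δ m m' A B s} :
      Erase Γ Δ m m' A → LTyped Γ B (.srt s) → Conv A B →
      Erase Γ Δ m m' B

/-- Heaps: finite maps from locations to sort-annotated values. -/
abbrev Heap := Nat → Option (Srt × Tm)

/-- Heap lookup `Lookup H₁ l v H₂`: non-linear cells persist, linear cells
are deallocated. -/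
inductive Lookup : Heap → Nat → Tm → Heap → Prop
  | u {H l v} : H l = some (.U, v) → Lookup H l v H
  | l {H l v} : H l = some (.L, v) → Lookup H l v (Function.update H l none)

/-- Heap merge `H₁ ∪̇ H₂ = H`. -/
def HMerge (H₁ H₂ H : Heap) : Prop := ∀ l,
  (H₁ l = none ∧ H₂ l = none ∧ H l = none) ∨
  (∃ v, H₁ l = some (.U, v) ∧ H₂ l = some (.U, v) ∧ H l = some (.U, v)) ∨
  (∃ v, H₁ l = some (.L, v) ∧ H₂ l = none ∧ H l = some (.L, v)) ∨
  (∃ v, H₁ l = none ∧ H₂ l = some (.L, v) ∧ H l = some (.L, v))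

/-- The heap constraint `H ▷ s`. -/
def HRestr (H : Heap) : Srt → Prop
  | .U => ∀ l s v, H l = some (s, v) → s = Srt.U
  | .L => True

/-- Heap reduction `H ; m ~~> H' ; m'`. -/
inductive HStep : Heap → Tm → Heap → Tm → Prop
  | alloc0 {H l t m} : H l = none →
      HStep H (.lam0 t .box m) (Function.update H l (some (t, .lam0 t .box m))) (.ptr l)
  | alloc1 {H l t m} : H l = none →
      HStep H (.lam1 t .box m) (Function.update H l (some (t, .lam1 t .box m))) (.ptr l)
  | appL {H H' m m' n} : HStep H m H' m' → HStep H (.app m n) H' (.app m' n)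
  | appR {H H' m n n'} : HStep H n H' n' → HStep H (.app m n) H' (.app m n')
  | beta0 {H H' l t m n} : Lookup H l (.lam0 t .box m) H' →
      HStep H (.app (.ptr l) n) H' (subst1 .box m)
  | beta1 {H H' l₁ l₂ t m} : Lookup H l₁ (.lam1 t .box m) H' →
      HStep H (.app (.ptr l₁) (.ptr l₂)) H' (subst1 (.ptr l₂) m)

/-- Pointer resolution `H ; m ~ n`. -/
inductive Resolve : Heap → Tm → Tm → Prop
  | var {H x} : HRestr H .U → Resolve H (.var x) (.var x)
  | lam0 {H t m' m} : HRestr H t → Resolve H m' m →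
      Resolve H (.lam0 t .box m') (.lam0 t .box m)
  | lam1 {H t m' m} : HRestr H t → Resolve H m' m →
      Resolve H (.lam1 t .box m') (.lam1 t .box m)
  | app0 {H m' m} : Resolve H m' m → Resolve H (.app m' .box) (.app m .box)
  | app1 {H₁ H₂ H m' m n' n} : HMerge H₁ H₂ H →
      Resolve H₁ m' m → Resolve H₂ n' n → Resolve H (.app m' n') (.app m n)
  | ptr {H H' l v' v} : Lookup H l v' H' → Resolve H' v' v → Resolve H (.ptr l) v

/-- `ClosedUnder k m`: all free de Bruijn variables of `m` are `< k`. -/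
def ClosedUnder : Nat → Tm → Prop
  | k, .var x => x < k
  | _, .srt _ => True
  | k, .pi0 _ A B => ClosedUnder k A ∧ ClosedUnder (k + 1) B
  | k, .pi1 _ A B => ClosedUnder k A ∧ ClosedUnder (k + 1) B
  | k, .lam0 _ A m => ClosedUnder k A ∧ ClosedUnder (k + 1) m
  | k, .lam1 _ A m => ClosedUnder k A ∧ ClosedUnder (k + 1) m
  | k, .app m n => ClosedUnder k m ∧ ClosedUnder k n
  | _, .box => True
  | _, .ptr _ => True

/-- WR-heaps: heaps plausibly produced by heap reduction. -/
inductive WrHeap : Heap → Prop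
  | nil : WrHeap (fun _ => none)
  | lam0 {H l t m} : ClosedUnder 1 m → WrHeap H → H l = none →
      WrHeap (Function.update H l (some (t, .lam0 t .box m)))
  | lam1 {H l t m} : ClosedUnder 1 m → WrHeap H → H l = none →
      WrHeap (Function.update H l (some (t, .lam1 t .box m)))

/-- Well-resolved `H ⊢ a ~ b ~ c : A`. -/
def WellResolved (H : Heap) (a b c A : Tm) : Prop :=
  Erase [] [] a b A ∧ Resolve H c b

/-! ### Renaming and substitution -/

theorem upr_comp (ζ ξ : Nat → Nat) : (fun x => upr ζ (upr ξ x)) = upr (fun x => ζ (ξ x)) := by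
  funext x; cases x <;> rfl

theorem rename_rename (ζ ξ : Nat → Nat) (m : Tm) :
    rename ζ (rename ξ m) = rename (fun x => ζ (ξ x)) m := by
  induction m generalizing ζ ξ <;> simp_all [rename, upr_comp]

theorem up_comp_upr (σ : Nat → Tm) (ξ : Nat → Nat) :
    (fun x => up σ (upr ξ x)) = up (fun x => σ (ξ x)) := by
  funext x; cases x <;> rfl

theorem subst_rename (σ : Nat → Tm) (ξ : Nat → Nat) (m : Tm) :
    subst σ (rename ξ m) = subst (fun x => σ (ξ x)) m := by
  induction m generalizing σ ξ <;> simp_all [rename, subst, up_comp_upr]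

theorem rename_comp_up (ξ : Nat → Nat) (σ : Nat → Tm) :
    (fun x => rename (upr ξ) (up σ x)) = up (fun x => rename ξ (σ x)) := by
  funext x; cases x <;> simp [up, rename, rename_rename, upr]

theorem rename_subst (ξ : Nat → Nat) (σ : Nat → Tm) (m : Tm) :
    rename ξ (subst σ m) = subst (fun x => rename ξ (σ x)) m := by
  induction m generalizing σ ξ <;> simp_all [rename, subst, rename_comp_up]

theorem subst_comp_up (τ σ : Nat → Tm) :
    (fun x => subst (up τ) (up σ x)) = up (fun x => subst τ (σ x)) := by
  funext x; cases x <;> simp [up, subst, subst_rename, rename_subst]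

theorem subst_subst (τ σ : Nat → Tm) (m : Tm) :
    subst τ (subst σ m) = subst (fun x => subst τ (σ x)) m := by
  induction m generalizing σ τ <;> simp_all [subst, subst_comp_up]

theorem up_var : up Tm.var = Tm.var := by
  funext x; cases x <;> rfl

theorem subst_var (m : Tm) : subst Tm.var m = m := by
  induction m <;> simp_all [subst, up_var]

theorem rename_eq_subst (ξ : Nat → Nat) (m : Tm) :
    rename ξ m = subst (fun x => .var (ξ x)) m := by
  rw [← subst_rename Tm.var, subst_var]

theorem subst_subst1 (σ : Nat → Tm) (n m : Tm) :
    subst σ (subst1 n m) = subst1 (subst σ n) (subst (up σ) m) := by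
  unfold subst1
  rw [subst_subst, subst_subst]
  congr 1
  funext x
  cases x with
  | zero => rfl
  | succ x => simp [up, subst, subst_rename, subst_var]

theorem rename_subst1 (ξ : Nat → Nat) (n m : Tm) :
    rename ξ (subst1 n m) = subst1 (rename ξ n) (rename (upr ξ) m) := by
  have h : (fun x => Tm.var (upr ξ x)) = up (fun x => Tm.var (ξ x)) := by
    funext x; cases x <;> rfl
  simp only [rename_eq_subst, subst_subst1, h]

/-! ### Confluence of logical reduction -/

theorem PStep.refl (m : Tm) : PStep m m := by
  induction m <;> constructor <;> assumption

theorem LStep.pStep {m n : Tm} (h : LStep m n) : PStep m n := by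
  induction h <;> constructor <;> first | assumption | exact PStep.refl _

theorem PStep.rename {m n : Tm} (h : PStep m n) (ξ : Nat → Nat) :
    PStep (rename ξ m) (rename ξ n) := by
  induction h generalizing ξ with
  | beta0 _ _ ihm ihn => rw [rename_subst1]; exact .beta0 (ihm _) (ihn _)
  | beta1 _ _ ihm ihn => rw [rename_subst1]; exact .beta1 (ihm _) (ihn _)
  | _ => constructor <;> solve_by_elim

theorem PStep.up {σ τ : Nat → Tm} (h : ∀ x, PStep (σ x) (τ x)) (x : Nat) :
    PStep (up σ x) (up τ x) := by
  cases x with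
  | zero => exact .var
  | succ x => exact (h x).rename _

theorem PStep.subst {m n : Tm} (h : PStep m n) {σ τ : Nat → Tm}
    (hσ : ∀ x, PStep (σ x) (τ x)) : PStep (subst σ m) (subst τ n) := by
  induction h generalizing σ τ with
  | var => exact hσ _
  | beta0 _ _ ihm ihn => rw [subst_subst1]; exact .beta0 (ihm (PStep.up hσ)) (ihn hσ)
  | beta1 _ _ ihm ihn => rw [subst_subst1]; exact .beta1 (ihm (PStep.up hσ)) (ihn hσ)
  | srt => exact .srt
  | box => exact .box
  | ptr => exact .ptr
  | pi0 _ _ ihA ihB => exact .pi0 (ihA hσ) (ihB (PStep.up hσ))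
  | pi1 _ _ ihA ihB => exact .pi1 (ihA hσ) (ihB (PStep.up hσ))
  | lam0 _ _ ihA ihB => exact .lam0 (ihA hσ) (ihB (PStep.up hσ))
  | lam1 _ _ ihA ihB => exact .lam1 (ihA hσ) (ihB (PStep.up hσ))
  | app _ _ ihm ihn => exact .app (ihm hσ) (ihn hσ)

theorem PStep.subst1 {m m' n n' : Tm} (hm : PStep m m') (hn : PStep n n') :
    PStep (subst1 n m) (subst1 n' m') := by
  refine hm.subst fun x => ?_
  cases x with
  | zero => exact hn
  | succ x => exact .var

/-- Complete development: contracts every redex of a term simultaneously. -/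
def dev : Tm → Tm
  | .var x => .var x
  | .srt s => .srt s
  | .pi0 t A B => .pi0 t (dev A) (dev B)
  | .pi1 t A B => .pi1 t (dev A) (dev B)
  | .lam0 t A m => .lam0 t (dev A) (dev m)
  | .lam1 t A m => .lam1 t (dev A) (dev m)
  | .app (.lam0 _ _ m) n => subst1 (dev n) (dev m)
  | .app (.lam1 _ _ m) n => subst1 (dev n) (dev m)
  | .app m n => .app (dev m) (dev n)
  | .box => .box
  | .ptr l => .ptr l

theorem PStep.to_dev {m n : Tm} (h : PStep m n) : PStep n (dev m) := by
  induction h with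
  | @app m m' n n' hm hn ihm ihn =>
    cases m with
    | lam0 t A b =>
      cases hm
      simp only [dev] at ihm ⊢
      cases ihm with
      | lam0 _ hb => exact .beta0 hb ihn
    | lam1 t A b =>
      cases hm
      simp only [dev] at ihm ⊢
      cases ihm with
      | lam1 _ hb => exact .beta1 hb ihn
    | _ => exact .app ihm ihn
  | beta0 _ _ ihm ihn => simpa only [dev] using ihm.subst1 ihn
  | beta1 _ _ ihm ihn => simpa only [dev] using ihm.subst1 ihn
  | _ => simp only [dev]; constructor <;> assumption

theorem Conv.join {A B : Tm} (h : Conv A B) :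
    Relation.Join (Relation.ReflTransGen PStep) A B := by
  have heq : Equivalence (Relation.Join (Relation.ReflTransGen PStep)) :=
    Relation.equivalence_join_reflTransGen fun a _ _ hb hc =>
      ⟨dev a, .single hb.to_dev, .single hc.to_dev⟩
  induction h with
  | rel _ _ h => exact ⟨_, .single h.pStep, .refl⟩
  | refl => exact heq.refl _
  | symm _ _ _ ih => exact heq.symm ih
  | trans _ _ _ _ _ ih₁ ih₂ => exact heq.trans ih₁ ih₂

theorem pi0_of_pStep_star {t : Srt} {A B C : Tm}
    (h : Relation.ReflTransGen PStep (.pi0 t A B) C) : ∃ A' B', C = .pi0 t A' B' := by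
  induction h with
  | refl => exact ⟨_, _, rfl⟩
  | tail _ hs ih =>
    obtain ⟨_, _, rfl⟩ := ih
    cases hs
    exact ⟨_, _, rfl⟩

theorem pi1_of_pStep_star {t : Srt} {A B C : Tm}
    (h : Relation.ReflTransGen PStep (.pi1 t A B) C) : ∃ A' B', C = .pi1 t A' B' := by
  induction h with
  | refl => exact ⟨_, _, rfl⟩
  | tail _ hs ih =>
    obtain ⟨_, _, rfl⟩ := ih
    cases hs
    exact ⟨_, _, rfl⟩

theorem not_conv_pi0_pi1 {t t' : Srt} {A B A' B' : Tm} :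
    ¬ Conv (.pi0 t A B) (.pi1 t' A' B') := fun h => by
  obtain ⟨C, h₀, h₁⟩ := h.join
  obtain ⟨_, _, rfl⟩ := pi0_of_pStep_star h₀
  obtain ⟨_, _, h⟩ := pi1_of_pStep_star h₁
  cases h

/-! ### Inversion of erasure -/

theorem Erase.conv_pi0_of_lam0 {Γ : Ctx} {Δ : PCtx} {a C m T : Tm} {t : Srt}
    (h : Erase Γ Δ a (.lam0 t C m) T) : ∃ A B, Conv (.pi0 t A B) T := by
  generalize hb : Tm.lam0 t C m = b at h
  induction h with
  | lam0 => cases hb; exact ⟨_, _, .refl _⟩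
  | conv _ _ hc ih =>
    obtain ⟨A, B, h⟩ := ih hb
    exact ⟨A, B, .trans _ _ _ h hc⟩
  | _ => cases hb

theorem Erase.conv_pi1_of_lam1 {Γ : Ctx} {Δ : PCtx} {a C m T : Tm} {t : Srt}
    (h : Erase Γ Δ a (.lam1 t C m) T) : ∃ A B, Conv (.pi1 t A B) T := by
  generalize hb : Tm.lam1 t C m = b at h
  induction h with
  | lam1 => cases hb; exact ⟨_, _, .refl _⟩
  | conv _ _ hc ih =>
    obtain ⟨A, B, h⟩ := ih hb
    exact ⟨A, B, .trans _ _ _ h hc⟩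
  | _ => cases hb

theorem Erase.ne_box {Γ : Ctx} {Δ : PCtx} {a b T : Tm} (h : Erase Γ Δ a b T) : b ≠ .box := by
  induction h <;> simp_all

/-! ### Heaps -/

/-- `H₁` is a restriction of the finite map `H₂`. -/
def SubHeap (H₁ H₂ : Heap) : Prop := ∀ l e, H₁ l = some e → H₂ l = some e

theorem HMerge.subHeap_left {H₁ H₂ H : Heap} (h : HMerge H₁ H₂ H) : SubHeap H₁ H := by
  intro l e he
  rcases h l with h | ⟨v, h⟩ | ⟨v, h⟩ | ⟨v, h⟩ <;> simp_all

theorem HMerge.subHeap_right {H₁ H₂ H : Heap} (h : HMerge H₁ H₂ H) : SubHeap H₂ H := by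
  intro l e he
  rcases h l with h | ⟨v, h⟩ | ⟨v, h⟩ | ⟨v, h⟩ <;> simp_all

theorem SubHeap.trans {H₁ H₂ H₃ : Heap} (h₁ : SubHeap H₁ H₂) (h₂ : SubHeap H₂ H₃) :
    SubHeap H₁ H₃ := fun l e he => h₂ l e (h₁ l e he)

theorem Lookup.eq_some {H H' : Heap} {l : Nat} {v : Tm} (h : Lookup H l v H') :
    ∃ s, H l = some (s, v) := by
  cases h <;> exact ⟨_, by assumption⟩

theorem Lookup.exists_of_eq_some {H : Heap} {l : Nat} {s : Srt} {v : Tm}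
    (h : H l = some (s, v)) : ∃ H', Lookup H l v H' := by
  cases s with
  | U => exact ⟨_, .u h⟩
  | L => exact ⟨_, .l h⟩

theorem WrHeap.exists_bound {H : Heap} (h : WrHeap H) : ∃ N, ∀ l, N ≤ l → H l = none := by
  induction h with
  | nil => exact ⟨0, fun _ _ => rfl⟩
  | @lam0 _ l _ _ _ _ _ ih | @lam1 _ l _ _ _ _ _ ih =>
    obtain ⟨N, hN⟩ := ih
    refine ⟨max N (l + 1), fun k hk => ?_⟩
    rw [Function.update_of_ne (by omega)]
    exact hN k (by omega)

theorem WrHeap.exists_fresh {H : Heap} (h : WrHeap H) : ∃ l, H l = none :=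
  let ⟨N, hN⟩ := h.exists_bound
  ⟨N, hN N le_rfl⟩

theorem WrHeap.eq_lam {H : Heap} (h : WrHeap H) {l : Nat} {s : Srt} {v : Tm}
    (hl : H l = some (s, v)) : (∃ t m, v = .lam0 t .box m) ∨ (∃ t m, v = .lam1 t .box m) := by
  induction h with
  | nil => cases hl
  | @lam0 _ k t m _ _ _ ih =>
    by_cases hk : l = k
    · subst hk
      rw [Function.update_self] at hl
      cases hl
      exact .inl ⟨_, _, rfl⟩
    · rw [Function.update_of_ne hk] at hl
      exact ih hl
  | @lam1 _ k t m _ _ _ ih =>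
    by_cases hk : l = k
    · subst hk
      rw [Function.update_self] at hl
      cases hl
      exact .inr ⟨_, _, rfl⟩
    · rw [Function.update_of_ne hk] at hl
      exact ih hl

theorem Resolve.lookup_lam0 {H₁ H Γ Δ} {l : Nat} {a b A B : Tm} {t : Srt}
    (hr : Resolve H₁ (.ptr l) b) (hs : SubHeap H₁ H) (hH : WrHeap H)
    (he : Erase Γ Δ a b (.pi0 t A B)) : ∃ H' t' m, Lookup H l (.lam0 t' .box m) H' := by
  cases hr with
  | ptr hl hr =>
    obtain ⟨s, h⟩ := hl.eq_some
    have h' := hs _ _ h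
    rcases hH.eq_lam h' with ⟨t', m, rfl⟩ | ⟨t', m, rfl⟩
    · obtain ⟨H', h⟩ := Lookup.exists_of_eq_some h'
      exact ⟨H', _, _, h⟩
    · cases hr
      obtain ⟨_, _, hc⟩ := he.conv_pi1_of_lam1
      exact absurd (.symm _ _ hc) not_conv_pi0_pi1

theorem Resolve.lookup_lam1 {H₁ H Γ Δ} {l : Nat} {a b A B : Tm} {t : Srt}
    (hr : Resolve H₁ (.ptr l) b) (hs : SubHeap H₁ H) (hH : WrHeap H)
    (he : Erase Γ Δ a b (.pi1 t A B)) : ∃ H' t' m, Lookup H l (.lam1 t' .box m) H' := by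
  cases hr with
  | ptr hl hr =>
    obtain ⟨s, h⟩ := hl.eq_some
    have h' := hs _ _ h
    rcases hH.eq_lam h' with ⟨t', m, rfl⟩ | ⟨t', m, rfl⟩
    · cases hr
      obtain ⟨_, _, hc⟩ := he.conv_pi0_of_lam0
      exact absurd hc not_conv_pi0_pi1
    · obtain ⟨H', h⟩ := Lookup.exists_of_eq_some h'
      exact ⟨H', _, _, h⟩

/-- Progress in a heap `H` for a term that resolves in a restriction of `H`. -/
theorem Erase.progress {H : Heap} (hH : WrHeap H) {Δ : PCtx} {a b A : Tm}
    (he : Erase [] Δ a b A) (hΔ : Δ = []) {H₁ : Heap} {c : Tm} (hr : Resolve H₁ c b)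
    (hs : SubHeap H₁ H) :
    (∃ H' c', HStep H c H' c') ∨ ∃ l, c = .ptr l := by
  generalize hΓ : ([] : Ctx) = Γ at he
  induction he generalizing H₁ c with
  | var _ h => subst hΔ; cases h
  | lam0 =>
    cases hr with
    | lam0 => exact .inl (hH.exists_fresh.elim fun l h => ⟨_, _, .alloc0 h⟩)
    | ptr => exact .inr ⟨_, rfl⟩
  | lam1 =>
    cases hr with
    | lam1 => exact .inl (hH.exists_fresh.elim fun l h => ⟨_, _, .alloc1 h⟩)
    | ptr => exact .inr ⟨_, rfl⟩
  | app0 hm _ ih =>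
    have key : ∀ {H₂ c₁ c₂}, Resolve H₂ c₁ _ → SubHeap H₂ H →
        ∃ H' c', HStep H (.app c₁ c₂) H' c' := fun hr hs => by
      rcases ih hΔ hr hs hΓ with ⟨H', c', h⟩ | ⟨l, rfl⟩
      · exact ⟨_, _, .appL h⟩
      · obtain ⟨_, _, _, h⟩ := hr.lookup_lam0 hs hH hm
        exact ⟨_, _, .beta0 h⟩
    cases hr with
    | app0 hr => exact .inl (key hr hs)
    | app1 hM hr _ => exact .inl (key hr (hM.subHeap_left.trans hs))
    | ptr => exact .inr ⟨_, rfl⟩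
  | app1 hm hn hM ihm ihn =>
    subst hΔ
    cases hM
    cases hr with
    | app0 => exact absurd rfl hn.ne_box
    | app1 hM hr₁ hr₂ =>
      have hs₁ := hM.subHeap_left.trans hs
      rcases ihm rfl hr₁ hs₁ hΓ with ⟨_, _, h⟩ | ⟨l₁, rfl⟩
      · exact .inl ⟨_, _, .appL h⟩
      rcases ihn rfl hr₂ (hM.subHeap_right.trans hs) hΓ with ⟨_, _, h⟩ | ⟨l₂, rfl⟩
      · exact .inl ⟨_, _, .appR h⟩
      obtain ⟨_, _, _, h⟩ := hr₁.lookup_lam1 hs₁ hH hm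
      exact .inl ⟨_, _, .beta1 h⟩
    | ptr => exact .inr ⟨_, rfl⟩
  | conv _ _ _ ih => exact ih hΔ hr hs hΓ

/-- Heap progress. -/
theorem heap_progress {H : Heap} {a b c A : Tm}
    (hwr : WellResolved H a b c A) (hH : WrHeap H) :
    (∃ (H' : Heap) (c' : Tm), HStep H c H' c') ∨ (∃ l : Nat, c = Tm.ptr l) := by
  exact hwr.1.progress hH rfl hwr.2 fun _ _ h => h
end TLL
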